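/- Let ℓ ≥ 3 and let ī, j̄ ∈ ℤ/ℓℤ with j̄ = ī + 1 or j̄ = ī − 1 in ℤ/ℓℤ. Then the Misra–Miwa operators on the v-deformed Fock space F_v satisfy the quantum Serre relation E_ī² E_j̄ − (v + v⁻¹) E_ī E_j̄ E_ī + E_j̄ E_ī² = 0 as ℚ(v)-linear endomorphisms of F_v. -/

import Mathlib

open scoped Classical

namespace MisraMiwa

/-- The content of a box `b = (i, j)` (row `i`, column `j`, indexed from 0): column minus row. -/
def content (b : ℕ × ℕ) : ℤ := (b.2 : ℤ) - (b.1 : ℤ)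

/-- The color of a box: its content modulo `ℓ`. -/
def color (ℓ : ℕ) (b : ℕ × ℕ) : ZMod ℓ := (content b : ZMod ℓ)

/-- `b` is an addable box of the partition (Young diagram) `μ`. -/
def IsAddable (μ : YoungDiagram) (b : ℕ × ℕ) : Prop :=
  b ∉ μ ∧ ∃ ν : YoungDiagram, (ν : Set (ℕ × ℕ)) = insert b (μ : Set (ℕ × ℕ))

/-- `b` is a removable box of the partition (Young diagram) `μ`. -/
def IsRemovable (μ : YoungDiagram) (b : ℕ × ℕ) : Prop :=
  b ∈ μ ∧ ∃ ν : YoungDiagram, (ν : Set (ℕ × ℕ)) = (μ : Set (ℕ × ℕ)) \ {b}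

/-- The partition obtained from `μ` by adding the addable box `b`. -/
noncomputable def added (μ : YoungDiagram) (b : ℕ × ℕ) : YoungDiagram :=
  if h : IsAddable μ b then h.2.choose else μ

/-- The partition obtained from `μ` by removing the removable box `b`. -/
noncomputable def erased (μ : YoungDiagram) (b : ℕ × ℕ) : YoungDiagram :=
  if h : IsRemovable μ b then h.2.choose else μ

/-- `A ℓ i μ` : the set of addable boxes of `μ` of color `i`. -/
def A (ℓ : ℕ) (i : ZMod ℓ) (μ : YoungDiagram) : Set (ℕ × ℕ) :=
  {b | IsAddable μ b ∧ color ℓ b = i}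

/-- `R ℓ i μ` : the set of removable boxes of `μ` of color `i`. -/
def R (ℓ : ℕ) (i : ZMod ℓ) (μ : YoungDiagram) : Set (ℕ × ℕ) :=
  {b | IsRemovable μ b ∧ color ℓ b = i}

/-- `Nc ℓ i μ = #A_i(μ) - #R_i(μ)`. -/
noncomputable def Nc (ℓ : ℕ) (i : ZMod ℓ) (μ : YoungDiagram) : ℤ :=
  ((A ℓ i μ).ncard : ℤ) - ((R ℓ i μ).ncard : ℤ)

/-- `b'` is to the left of `b` : its content is strictly larger. -/
def LeftOf (b' b : ℕ × ℕ) : Prop := content b < content b'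

/-- `b'` is to the right of `b` : its content is strictly smaller. -/
def RightOf (b' b : ℕ × ℕ) : Prop := content b' < content b

/-- `Nl ℓ i μ b` : number of removable boxes of `μ` of color `i` to the left of `b`
minus number of addable boxes of `μ` of color `i` to the left of `b`. -/
noncomputable def Nl (ℓ : ℕ) (i : ZMod ℓ) (μ : YoungDiagram) (b : ℕ × ℕ) : ℤ :=
  ({b' | b' ∈ R ℓ i μ ∧ LeftOf b' b}.ncard : ℤ) - ({b' | b' ∈ A ℓ i μ ∧ LeftOf b' b}.ncard : ℤ)

/-- `Nr ℓ i μ b` : as `Nl`, but to the right of `b`. -/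
noncomputable def Nr (ℓ : ℕ) (i : ZMod ℓ) (μ : YoungDiagram) (b : ℕ × ℕ) : ℤ :=
  ({b' | b' ∈ R ℓ i μ ∧ RightOf b' b}.ncard : ℤ) - ({b' | b' ∈ A ℓ i μ ∧ RightOf b' b}.ncard : ℤ)

/-- The `v`-deformed Fock space: the `ℚ(v)`-vector space with basis indexed by partitions. -/
abbrev Fock : Type := YoungDiagram →₀ RatFunc ℚ

/-- The indeterminate `v` of `ℚ(v)`. -/
noncomputable def v : RatFunc ℚ := RatFunc.X

/-- `E_i |λ⟩ = Σ_μ v^(-N^r_i(λ/μ)) |μ⟩`, sum over `μ ⊂ λ` with `λ/μ` one box of color `i`. -/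
noncomputable def Evec (ℓ : ℕ) (i : ZMod ℓ) (lam : YoungDiagram) : Fock :=
  ∑ᶠ b ∈ R ℓ i lam,
    v ^ (-Nr ℓ i (erased lam b) b) • Finsupp.single (erased lam b) (1 : RatFunc ℚ)

/-- `F_i |λ⟩ = Σ_μ v^(N^l_i(μ/λ)) |μ⟩`, sum over `μ ⊃ λ` with `μ/λ` one box of color `i`. -/
noncomputable def Fvec (ℓ : ℕ) (i : ZMod ℓ) (lam : YoungDiagram) : Fock :=
  ∑ᶠ b ∈ A ℓ i lam,
    v ^ (Nl ℓ i lam b) • Finsupp.single (added lam b) (1 : RatFunc ℚ)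

/-- The Misra–Miwa operator `E_i`. -/
noncomputable def Eop (ℓ : ℕ) (i : ZMod ℓ) : Fock →ₗ[RatFunc ℚ] Fock :=
  Finsupp.lsum (RatFunc ℚ) fun lam => LinearMap.toSpanSingleton (RatFunc ℚ) Fock (Evec ℓ i lam)

/-- The Misra–Miwa operator `F_i`. -/
noncomputable def Fop (ℓ : ℕ) (i : ZMod ℓ) : Fock →ₗ[RatFunc ℚ] Fock :=
  Finsupp.lsum (RatFunc ℚ) fun lam => LinearMap.toSpanSingleton (RatFunc ℚ) Fock (Fvec ℓ i lam)

/-- The Misra–Miwa operator `K_i` : `K_i |λ⟩ = v^(N_i(λ)) |λ⟩`. -/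
noncomputable def Kop (ℓ : ℕ) (i : ZMod ℓ) : Fock →ₗ[RatFunc ℚ] Fock :=
  Finsupp.lsum (RatFunc ℚ) fun lam =>
    LinearMap.toSpanSingleton (RatFunc ℚ) Fock (v ^ Nc ℓ i lam • Finsupp.single lam (1 : RatFunc ℚ))

/-- The inverse operator `K_i⁻¹ |λ⟩ = v^(-N_i(λ)) |λ⟩`. -/
noncomputable def Kinvop (ℓ : ℕ) (i : ZMod ℓ) : Fock →ₗ[RatFunc ℚ] Fock :=
  Finsupp.lsum (RatFunc ℚ) fun lam =>
    LinearMap.toSpanSingleton (RatFunc ℚ) Fock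
      (v ^ (-Nc ℓ i lam) • Finsupp.single lam (1 : RatFunc ℚ))

/-- The Cartan matrix entry of affine type `A^{(1)}_{ℓ-1}`. -/
noncomputable def cartan (ℓ : ℕ) (i j : ZMod ℓ) : ℤ :=
  2 * (if i = j then 1 else 0)
    - (({1, -1} : Finset ℤ).filter (fun e => j = i + (e : ZMod ℓ))).card

/-- The `q`-integer `[n] = (q^n - q^{-n})/(q - q⁻¹)` in `ℚ(q)` (here `q = v`). -/
noncomputable def qint (n : ℤ) : RatFunc ℚ := (v ^ n - v ^ (-n)) / (v - v⁻¹)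

/-- `hasVal p x n` : the nonzero rational function `x` has `p`-adic valuation `n`. -/
def hasVal (p : Polynomial ℚ) (x : RatFunc ℚ) (n : ℤ) : Prop :=
  ∃ a b : Polynomial ℚ, ¬ p ∣ a ∧ ¬ p ∣ b ∧
    x = algebraMap (Polynomial ℚ) (RatFunc ℚ) p ^ n *
        (algebraMap (Polynomial ℚ) (RatFunc ℚ) a / algebraMap (Polynomial ℚ) (RatFunc ℚ) b)

/-- Addable boxes of `μ` in rows strictly above row `k` (rows indexed from 0). -/
def Alt (μ : YoungDiagram) (k : ℕ) : Set (ℕ × ℕ) := {b | IsAddable μ b ∧ b.1 < k}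

/-- Removable boxes of `μ` in rows strictly above row `k` (rows indexed from 0). -/
def Rlt (μ : YoungDiagram) (k : ℕ) : Set (ℕ × ℕ) := {b | IsRemovable μ b ∧ b.1 < k}

/-- The degree-`n` component of Fock space: the span of `|λ⟩` for `|λ| = n`. -/
noncomputable def degComp (n : ℕ) : Submodule (RatFunc ℚ) Fock :=
  Submodule.span (RatFunc ℚ)
    {f | ∃ lam : YoungDiagram, lam.card = n ∧ f = Finsupp.single lam (1 : RatFunc ℚ)}



/-! ### Extended membership and the profile of a diagram -/

/-- Membership in the diagram extended by all pairs with a negative coordinate. -/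
def ext (μ : YoungDiagram) (r s : ℤ) : Prop := r < 0 ∨ s < 0 ∨ (r.toNat, s.toNat) ∈ μ

theorem ext_mono (μ : YoungDiagram) {r s r' s' : ℤ} (hr : r' ≤ r) (hs : s' ≤ s)
    (h : ext μ r s) : ext μ r' s' := by
  unfold ext at *
  rcases h with h | h | h
  · left; omega
  · right; left; omega
  · right; right
    exact μ.up_left_mem (by omega) (by omega) h

theorem ext_nat (μ : YoungDiagram) (a b : ℕ) : ext μ a b ↔ (a, b) ∈ μ := by
  unfold ext
  have h1 : ¬ ((a : ℤ) < 0) := by omega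
  have h2 : ¬ ((b : ℤ) < 0) := by omega
  simp [h1, h2]

theorem exists_prof (μ : YoungDiagram) (x : ℤ) :
    ∃ p : ℤ, ∀ r : ℤ, ext μ r (r + x) ↔ r < p := by
  have hb : ∃ b : ℤ, ∀ z : ℤ, ¬ ext μ z (z + x) → b ≤ z := by
    refine ⟨0, fun z hz => ?_⟩
    by_contra hlt
    exact hz (Or.inl (by omega))
  have hi : ∃ z : ℤ, ¬ ext μ z (z + x) := by
    by_contra hcon
    push Not at hcon
    have hinj : Set.InjOn (fun n : ℕ => (n + x.natAbs, ((n + x.natAbs : ℤ) + x).toNat)) Set.univ := by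
      intro a _ b _ hab
      simp only [Prod.mk.injEq] at hab
      omega
    have hinf := Set.infinite_univ.image hinj
    apply hinf
    refine Set.Finite.subset (μ.cells.finite_toSet) ?_
    rintro _ ⟨n, -, rfl⟩
    have := hcon ((n + x.natAbs : ℕ) : ℤ)
    rcases this with h | h | h
    · omega
    · omega
    · rw [Int.toNat_natCast, Nat.cast_add] at h
      exact h
  obtain ⟨p, hp, hmin⟩ := Int.exists_least_of_bdd hb hi
  refine ⟨p, fun r => ⟨fun h => ?_, fun h => ?_⟩⟩
  · by_contra hlt
    exact hp (ext_mono μ (by omega) (by omega) h)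
  · by_contra hn
    have := hmin r hn
    omega

/-- The profile: first row (in the extended sense) on the diagonal `x` outside of `μ`. -/
noncomputable def prof (μ : YoungDiagram) (x : ℤ) : ℤ := (exists_prof μ x).choose

theorem prof_spec (μ : YoungDiagram) (x r : ℤ) : ext μ r (r + x) ↔ r < prof μ x :=
  (exists_prof μ x).choose_spec r

theorem ext_iff (μ : YoungDiagram) (r s : ℤ) : ext μ r s ↔ r < prof μ (s - r) := by
  rw [← prof_spec]; simp

theorem mem_iff (μ : YoungDiagram) (b : ℕ × ℕ) : b ∈ μ ↔ (b.1 : ℤ) < prof μ (content b) := by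
  rw [← Prod.mk.eta (p := b), ← ext_nat, ext_iff]; rfl

theorem prof_nonneg (μ : YoungDiagram) (x : ℤ) : 0 ≤ prof μ x ∧ 0 ≤ prof μ x + x := by
  have h : ¬ ext μ (prof μ x) (prof μ x + x) := by rw [prof_spec]; omega
  unfold ext at h
  push Not at h
  exact ⟨h.1, h.2.1⟩

theorem prof_succ (μ : YoungDiagram) (x : ℤ) :
    prof μ (x + 1) ≤ prof μ x ∧ prof μ x ≤ prof μ (x + 1) + 1 := by
  constructor
  · by_contra hlt
    have h : ext μ (prof μ x) (prof μ x + (x + 1)) := by rw [prof_spec]; omega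
    have h2 := ext_mono μ (le_refl (prof μ x)) (show prof μ x + x ≤ _ by omega) h
    rw [prof_spec] at h2; omega
  · by_contra hlt
    have h : ext μ (prof μ x - 1) (prof μ x - 1 + x) := by rw [prof_spec]; omega
    have h2 := ext_mono μ (show prof μ x - 2 ≤ _ by omega)
      (show prof μ x - 2 + (x + 1) ≤ _ by omega) h
    rw [prof_spec] at h2; omega

theorem prof_pred (μ : YoungDiagram) (x : ℤ) :
    prof μ x ≤ prof μ (x - 1) ∧ prof μ (x - 1) ≤ prof μ x + 1 := by
  have := prof_succ μ (x - 1)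
  simpa using this

theorem prof_inj {μ ν : YoungDiagram} (h : ∀ x, prof μ x = prof ν x) : μ = ν := by
  apply YoungDiagram.ext
  ext b
  rw [YoungDiagram.mem_cells, YoungDiagram.mem_cells, mem_iff, mem_iff, h]

theorem prof_eq_of {μ : YoungDiagram} {x p : ℤ} (h : ∀ r, ext μ r (r + x) ↔ r < p) :
    prof μ x = p := by
  have h1 := h p
  have h2 := h (p - 1)
  rw [prof_spec] at h1 h2
  omega

/-- Removability at content `x` in terms of the profile. -/
def Rem (μ : YoungDiagram) (x : ℤ) : Prop :=
  prof μ (x - 1) = prof μ x ∧ prof μ (x + 1) = prof μ x - 1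

/-- Addability at content `x` in terms of the profile. -/
def Add (μ : YoungDiagram) (x : ℤ) : Prop :=
  prof μ (x - 1) = prof μ x + 1 ∧ prof μ (x + 1) = prof μ x

theorem isRemovable_iff (μ : YoungDiagram) (b : ℕ × ℕ) :
    IsRemovable μ b ↔ Rem μ (content b) ∧ (b.1 : ℤ) = prof μ (content b) - 1 := by
  obtain ⟨i, j⟩ := b
  constructor
  · rintro ⟨hb, ν, hν⟩
    have hmem : ∀ c, c ∈ ν ↔ c ∈ μ ∧ c ≠ (i, j) := by
      intro c
      have := Set.ext_iff.1 hν c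
      simpa using this
    have h1 : (i + 1, j) ∉ μ := by
      intro hc
      have : (i + 1, j) ∈ ν := (hmem _).2 ⟨hc, by simp⟩
      have := ν.up_left_mem (show i ≤ i + 1 by omega) le_rfl this
      exact ((hmem _).1 this).2 rfl
    have h2 : (i, j + 1) ∉ μ := by
      intro hc
      have : (i, j + 1) ∈ ν := (hmem _).2 ⟨hc, by simp⟩
      have := ν.up_left_mem le_rfl (show j ≤ j + 1 by omega) this
      exact ((hmem _).1 this).2 rfl
    rw [mem_iff] at hb h1 h2
    have e1 : content (i + 1, j) = content (i, j) - 1 := by simp [content]; ring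
    have e2 : content (i, j + 1) = content (i, j) + 1 := by simp [content]; ring
    rw [e1] at h1
    rw [e2] at h2
    have a1 := prof_succ μ (content (i, j))
    have a2 := prof_pred μ (content (i, j))
    push_cast at *
    refine ⟨⟨?_, ?_⟩, ?_⟩ <;> omega
  · rintro ⟨⟨h1, h2⟩, h3⟩
    have hb : (i, j) ∈ μ := by rw [mem_iff]; simp only at *; omega
    refine ⟨hb, ⟨μ.cells.erase (i, j), ?_⟩, ?_⟩
    · rintro ⟨a, b⟩ ⟨c, d⟩ hle hin
      simp only [Finset.coe_erase, Set.mem_sdiff, Finset.mem_coe, YoungDiagram.mem_cells,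
        Set.mem_singleton_iff] at hin ⊢
      refine ⟨μ.isLowerSet hle hin.1, ?_⟩
      rintro heq
      simp only [Prod.mk.injEq] at heq
      obtain ⟨rfl, rfl⟩ := heq
      obtain ⟨hle1, hle2⟩ := hle
      simp only at hle1 hle2
      have hne : c < a ∨ d < b := by
        by_contra hcon
        apply hin.2
        simp only [Prod.mk.injEq]; omega
      rcases hne with hne | hne
      · have hh := μ.up_left_mem (show c + 1 ≤ a by omega) hle2 hin.1
        rw [mem_iff] at hh
        have e1 : content (c + 1, d) = content (c, d) - 1 := by simp [content]; ring
        rw [e1] at hh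
        push_cast at hh
        simp only at *
        omega
      · have hh := μ.up_left_mem hle1 (show d + 1 ≤ b by omega) hin.1
        rw [mem_iff] at hh
        have e1 : content (c, d + 1) = content (c, d) + 1 := by simp [content]; ring
        rw [e1] at hh
        simp only at *
        omega
    · ext c
      change c ∈ μ.cells.erase (i, j) ↔ _
      simp only [SetLike.mem_coe, Finset.mem_erase, YoungDiagram.mem_cells,
        Set.mem_sdiff, Set.mem_singleton_iff]
      tauto

theorem isAddable_iff (μ : YoungDiagram) (b : ℕ × ℕ) :
    IsAddable μ b ↔ Add μ (content b) ∧ (b.1 : ℤ) = prof μ (content b) := by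
  obtain ⟨i, j⟩ := b
  have a1 := prof_succ μ (content (i, j))
  have a2 := prof_pred μ (content (i, j))
  constructor
  · rintro ⟨hb, ν, hν⟩
    have hmem : ∀ c, c ∈ ν ↔ c = (i, j) ∨ c ∈ μ := by
      intro c
      have := Set.ext_iff.1 hν c
      simpa using this
    have hij : (i, j) ∈ ν := (hmem _).2 (Or.inl rfl)
    have h1 : ext μ (i - 1) j := by
      rcases i with _ | i
      · left; simp
      · have := ν.up_left_mem (show i ≤ i + 1 by omega) le_rfl hij
        have := (hmem _).1 this
        simp only [Prod.mk.injEq] at this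
        have : (i, j) ∈ μ := by
          rcases this with h | h
          · omega
          · exact h
        rw [← ext_nat] at this
        simpa using this
    have h2 : ext μ i (j - 1) := by
      rcases j with _ | j
      · right; left; simp
      · have := ν.up_left_mem le_rfl (show j ≤ j + 1 by omega) hij
        have := (hmem _).1 this
        simp only [Prod.mk.injEq] at this
        have : (i, j) ∈ μ := by
          rcases this with h | h
          · omega
          · exact h
        rw [← ext_nat] at this
        simpa using this
    rw [mem_iff] at hb
    rw [ext_iff] at h1 h2
    have e1 : (j : ℤ) - (i - 1) = content (i, j) + 1 := by simp [content]; ring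
    have e2 : (j : ℤ) - 1 - i = content (i, j) - 1 := by simp [content]; ring
    rw [e1] at h1
    rw [e2] at h2
    refine ⟨⟨?_, ?_⟩, ?_⟩ <;> simp only at * <;> omega
  · rintro ⟨⟨h1, h2⟩, h3⟩
    have hb : (i, j) ∉ μ := by rw [mem_iff]; simp only at *; omega
    refine ⟨hb, ⟨insert (i, j) μ.cells, ?_⟩, ?_⟩
    · rintro ⟨a, b⟩ ⟨c, d⟩ hle hin
      simp only [Finset.coe_insert, Set.mem_insert_iff, Finset.mem_coe, YoungDiagram.mem_cells]
        at hin ⊢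
      rcases hin with hin | hin
      · simp only [Prod.mk.injEq] at hin
        obtain ⟨rfl, rfl⟩ := hin
        obtain ⟨hle1, hle2⟩ := hle
        simp only at hle1 hle2
        by_cases hc : c = a ∧ d = b
        · left; rw [hc.1, hc.2]
        · right
          rcases (show c < a ∨ d < b by omega) with hlt | hlt
          · rw [← ext_nat]
            apply ext_mono μ (show (c : ℤ) ≤ (a : ℤ) - 1 by omega) (show (d : ℤ) ≤ (b : ℤ) by omega)
            rw [ext_iff]
            have e1 : (b : ℤ) - (a - 1) = content (a, b) + 1 := by simp [content]; ring
            rw [e1]; simp only at *; omega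
          · rw [← ext_nat]
            apply ext_mono μ (show (c : ℤ) ≤ (a : ℤ) by omega) (show (d : ℤ) ≤ (b : ℤ) - 1 by omega)
            rw [ext_iff]
            have e1 : (b : ℤ) - 1 - a = content (a, b) - 1 := by simp [content]; ring
            rw [e1]; simp only at *; omega
      · right; exact μ.isLowerSet hle hin
    · ext c
      change c ∈ insert (i, j) μ.cells ↔ _
      simp only [SetLike.mem_coe, Finset.mem_insert, YoungDiagram.mem_cells,
        Set.mem_insert_iff]

/-- The last box of `μ` on the diagonal `x`. -/
noncomputable def rbox (μ : YoungDiagram) (x : ℤ) : ℕ × ℕ :=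
  ((prof μ x - 1).toNat, (prof μ x - 1 + x).toNat)

/-- The first box outside of `μ` on the diagonal `x`. -/
noncomputable def abox (μ : YoungDiagram) (x : ℤ) : ℕ × ℕ :=
  ((prof μ x).toNat, (prof μ x + x).toNat)

theorem Rem.pos {μ : YoungDiagram} {x : ℤ} (h : Rem μ x) :
    0 ≤ prof μ x - 1 ∧ 0 ≤ prof μ x - 1 + x := by
  obtain ⟨h1, h2⟩ := h
  have a1 := prof_nonneg μ (x + 1)
  have a2 := prof_nonneg μ (x - 1)
  omega

theorem content_rbox {μ : YoungDiagram} {x : ℤ} (h : Rem μ x) : content (rbox μ x) = x := by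
  have := h.pos
  simp only [content, rbox]; omega

theorem content_abox (μ : YoungDiagram) (x : ℤ) : content (abox μ x) = x := by
  have := prof_nonneg μ x
  simp only [content, abox]; omega

theorem isRemovable_rbox {μ : YoungDiagram} {x : ℤ} (h : Rem μ x) : IsRemovable μ (rbox μ x) := by
  rw [isRemovable_iff, content_rbox h]
  refine ⟨h, ?_⟩
  have := h.pos
  simp only [rbox]; omega

theorem isAddable_abox {μ : YoungDiagram} {x : ℤ} (h : Add μ x) : IsAddable μ (abox μ x) := by
  rw [isAddable_iff, content_abox]
  refine ⟨h, ?_⟩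
  have := prof_nonneg μ x
  simp only [abox]; omega

theorem box_ext {b b' : ℕ × ℕ} (h1 : (b.1 : ℤ) = b'.1) (h2 : content b = content b') : b = b' := by
  simp only [content] at h2
  ext <;> omega

theorem eq_rbox {μ : YoungDiagram} {b : ℕ × ℕ} (h : IsRemovable μ b) : b = rbox μ (content b) := by
  have h1 := (isRemovable_iff μ b).1 h
  have h2 := (isRemovable_iff _ _).1 (isRemovable_rbox h1.1)
  rw [content_rbox h1.1] at h2
  exact box_ext (by omega) (content_rbox h1.1).symm

theorem eq_abox {μ : YoungDiagram} {b : ℕ × ℕ} (h : IsAddable μ b) : b = abox μ (content b) := by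
  have h1 := (isAddable_iff μ b).1 h
  have h2 := (isAddable_iff _ _).1 (isAddable_abox h1.1)
  rw [content_abox] at h2
  exact box_ext (by omega) (content_abox _ _).symm

/-- Remove the box of content `x`. -/
noncomputable def rm (μ : YoungDiagram) (x : ℤ) : YoungDiagram := erased μ (rbox μ x)

theorem mem_rm {μ : YoungDiagram} {x : ℤ} (h : Rem μ x) (c : ℕ × ℕ) :
    c ∈ rm μ x ↔ c ∈ μ ∧ c ≠ rbox μ x := by
  have hr := isRemovable_rbox h
  have := hr.2.choose_spec
  rw [rm, erased, dif_pos hr]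
  have := Set.ext_iff.1 this c
  simpa using this

theorem prof_rm {μ : YoungDiagram} {x : ℤ} (h : Rem μ x) (y : ℤ) :
    prof (rm μ x) y = if y = x then prof μ x - 1 else prof μ y := by
  apply prof_eq_of
  intro r
  have hp := h.pos
  have key : ext (rm μ x) r (r + y) ↔ ext μ r (r + y) ∧ ¬ (r = prof μ x - 1 ∧ y = x) := by
    unfold ext
    rw [mem_rm h]
    simp only [rbox, ne_eq, Prod.mk.injEq]
    by_cases h0 : r < 0
    · simp only [h0, true_or, true_and, true_iff]; omega
    · by_cases h1 : r + y < 0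
      · simp only [h1, true_or, or_true, true_and, true_iff]; omega
      · simp only [h0, h1, false_or]
        apply and_congr_right
        intro _
        omega
  rw [key, prof_spec]
  split_ifs with hy
  · subst hy; omega
  · simp [hy]

theorem rm_le {μ : YoungDiagram} {x : ℤ} (h : Rem μ x) : rm μ x ≤ μ := by
  intro c hc
  exact ((mem_rm h c).1 hc).1

/-! ### The second difference and the exponents -/

/-- Second difference of the profile. -/
noncomputable def dd (μ : YoungDiagram) (x : ℤ) : ℤ := prof μ (x - 1) - 2 * prof μ x + prof μ (x + 1)

theorem dd_eq (μ : YoungDiagram) (x : ℤ) :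
    dd μ x = (if Add μ x then 1 else 0) - (if Rem μ x then 1 else 0) := by
  have a1 := prof_succ μ x
  have a2 := prof_pred μ x
  unfold dd Add Rem
  split_ifs <;> omega

/-- The contents of the boxes of a diagram. -/
noncomputable def conts (μ : YoungDiagram) : Finset ℤ := μ.cells.image content

theorem Rem.mem_conts {μ : YoungDiagram} {x : ℤ} (h : Rem μ x) : x ∈ conts μ := by
  rw [conts, Finset.mem_image]
  exact ⟨rbox μ x, (isRemovable_rbox h).1, content_rbox h⟩

theorem prof_triv {μ : YoungDiagram} {x : ℤ} (h : x ∉ conts μ) : prof μ x = max 0 (-x) := by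
  have a := prof_nonneg μ x
  by_contra hne
  apply h
  have h1 : 0 ≤ prof μ x - 1 ∧ 0 ≤ prof μ x - 1 + x := by omega
  rw [conts, Finset.mem_image]
  refine ⟨((prof μ x - 1).toNat, (prof μ x - 1 + x).toNat), ?_, ?_⟩
  · rw [YoungDiagram.mem_cells, ← ext_nat, Int.toNat_of_nonneg h1.1, Int.toNat_of_nonneg h1.2,
      prof_spec]
    omega
  · simp only [content]; omega

/-- A finite set of contents which contains all addable and removable ones. -/
noncomputable def Dset (μ : YoungDiagram) : Finset ℤ :=
  insert 0 (conts μ ∪ (conts μ).image (· + 1) ∪ (conts μ).image (· - 1))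

theorem not_mem_Dset {μ : YoungDiagram} {x : ℤ} (h : x ∉ Dset μ) :
    x ≠ 0 ∧ x ∉ conts μ ∧ x - 1 ∉ conts μ ∧ x + 1 ∉ conts μ := by
  simp only [Dset, Finset.mem_insert, Finset.mem_union, Finset.mem_image, not_or, not_exists,
    not_and] at h
  obtain ⟨h0, ⟨h1, h2⟩, h3⟩ := h
  exact ⟨h0, h1, fun h => h2 _ h (by ring), fun h => h3 _ h (by ring)⟩

theorem mem_Dset_of {μ : YoungDiagram} {x : ℤ} (h : Add μ x ∨ Rem μ x) : x ∈ Dset μ := by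
  by_contra hx
  obtain ⟨h0, h1, h2, h3⟩ := not_mem_Dset hx
  have e1 := prof_triv h1
  have e2 := prof_triv h2
  have e3 := prof_triv h3
  unfold Add Rem at h
  omega

theorem dd_support {μ : YoungDiagram} {x : ℤ} (h : dd μ x ≠ 0) : x ∈ Dset μ := by
  apply mem_Dset_of
  rw [dd_eq] at h
  by_contra hcon
  push Not at hcon
  simp [hcon.1, hcon.2] at h

/-- The (negated) exponent. -/
noncomputable def gg (ℓ : ℕ) (μ : YoungDiagram) (i : ZMod ℓ) (c : ℤ) : ℤ :=
  ∑ᶠ x : ℤ, if x < c ∧ (x : ZMod ℓ) = i then dd μ x else 0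

theorem gg_eq_sum (ℓ : ℕ) (μ : YoungDiagram) (i : ZMod ℓ) (c : ℤ) (D : Finset ℤ)
    (hD : Dset μ ⊆ D) :
    gg ℓ μ i c = ∑ x ∈ D, if x < c ∧ (x : ZMod ℓ) = i then dd μ x else 0 := by
  apply finsum_eq_sum_of_support_subset
  intro x hx
  rw [Function.mem_support] at hx
  apply hD
  apply dd_support
  intro h0
  simp [h0] at hx

theorem ncard_R (ℓ : ℕ) (i : ZMod ℓ) (μ : YoungDiagram) (b : ℕ × ℕ) :
    ({b' | b' ∈ R ℓ i μ ∧ RightOf b' b}.ncard : ℤ) =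
      ∑ x ∈ Dset μ, if x < content b ∧ (x : ZMod ℓ) = i then (if Rem μ x then 1 else 0) else 0 := by
  have himg : {b' | b' ∈ R ℓ i μ ∧ RightOf b' b} = (rbox μ) ''
      (((Dset μ).filter (fun x => (x < content b ∧ (x : ZMod ℓ) = i) ∧ Rem μ x) : Finset ℤ) :
        Set ℤ) := by
    ext b'
    simp only [Set.mem_ofPred_eq, R, RightOf, color, Set.mem_image, Finset.coe_filter]
    constructor
    · rintro ⟨⟨h1, h2⟩, h3⟩
      have hr := ((isRemovable_iff μ b').1 h1).1
      exact ⟨content b', ⟨mem_Dset_of (Or.inr hr), ⟨h3, h2⟩, hr⟩, (eq_rbox h1).symm⟩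
    · rintro ⟨x, ⟨-, ⟨h3, h2⟩, h1⟩, rfl⟩
      rw [content_rbox h1]
      exact ⟨⟨isRemovable_rbox h1, h2⟩, h3⟩
  rw [himg, Set.InjOn.ncard_image, Set.ncard_coe_finset, Finset.card_filter]
  · push_cast
    apply Finset.sum_congr rfl
    intro x _
    split_ifs <;> simp_all
  · intro x hx y hy hxy
    simp only [Finset.coe_filter, Set.mem_ofPred_eq] at hx hy
    rw [← content_rbox hx.2.2, hxy, content_rbox hy.2.2]

theorem ncard_A (ℓ : ℕ) (i : ZMod ℓ) (μ : YoungDiagram) (b : ℕ × ℕ) :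
    ({b' | b' ∈ A ℓ i μ ∧ RightOf b' b}.ncard : ℤ) =
      ∑ x ∈ Dset μ, if x < content b ∧ (x : ZMod ℓ) = i then (if Add μ x then 1 else 0) else 0 := by
  have himg : {b' | b' ∈ A ℓ i μ ∧ RightOf b' b} = (abox μ) ''
      (((Dset μ).filter (fun x => (x < content b ∧ (x : ZMod ℓ) = i) ∧ Add μ x) : Finset ℤ) :
        Set ℤ) := by
    ext b'
    simp only [Set.mem_ofPred_eq, A, RightOf, color, Set.mem_image, Finset.coe_filter]
    constructor
    · rintro ⟨⟨h1, h2⟩, h3⟩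
      have hr := ((isAddable_iff μ b').1 h1).1
      exact ⟨content b', ⟨mem_Dset_of (Or.inl hr), ⟨h3, h2⟩, hr⟩, (eq_abox h1).symm⟩
    · rintro ⟨x, ⟨-, ⟨h3, h2⟩, h1⟩, rfl⟩
      rw [content_abox]
      exact ⟨⟨isAddable_abox h1, h2⟩, h3⟩
  rw [himg, Set.InjOn.ncard_image, Set.ncard_coe_finset, Finset.card_filter]
  · push_cast
    apply Finset.sum_congr rfl
    intro x _
    split_ifs <;> simp_all
  · intro x hx y hy hxy
    rw [← content_abox μ x, hxy, content_abox]

theorem neg_Nr (ℓ : ℕ) (i : ZMod ℓ) (μ : YoungDiagram) (b : ℕ × ℕ) :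
    - Nr ℓ i μ b = gg ℓ μ i (content b) := by
  rw [gg_eq_sum ℓ μ i _ (Dset μ) (Finset.Subset.refl _), Nr, ncard_R, ncard_A, neg_sub,
    ← Finset.sum_sub_distrib]
  apply Finset.sum_congr rfl
  intro x _
  rw [dd_eq]
  split_ifs <;> simp_all

/-- The change of the exponent at content `c` when a box of content `c0` is removed. -/
noncomputable def qq (ℓ : ℕ) (c0 : ℤ) (i : ZMod ℓ) (c : ℤ) : ℤ :=
  2 * (if c0 < c ∧ (c0 : ZMod ℓ) = i then 1 else 0)
    - (if c0 + 1 < c ∧ ((c0 + 1 : ℤ) : ZMod ℓ) = i then 1 else 0)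
    - (if c0 - 1 < c ∧ ((c0 - 1 : ℤ) : ZMod ℓ) = i then 1 else 0)

theorem dd_rm {μ : YoungDiagram} {c0 : ℤ} (h : Rem μ c0) (x : ℤ) :
    dd (rm μ c0) x = dd μ x + (2 * (if x = c0 then 1 else 0) - (if x = c0 + 1 then 1 else 0)
      - (if x = c0 - 1 then 1 else 0)) := by
  unfold dd
  rw [prof_rm h, prof_rm h, prof_rm h]
  by_cases h1 : x = c0
  · subst h1
    simp; omega
  by_cases h2 : x = c0 + 1
  · subst h2
    simp; omega
  by_cases h3 : x = c0 - 1
  · subst h3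
    simp; omega
  have e1 : x - 1 ≠ c0 := by omega
  have e2 : x + 1 ≠ c0 := by omega
  simp [h1, h2, h3, e1, e2]

theorem gg_rm (ℓ : ℕ) {μ : YoungDiagram} {c0 : ℤ} (h : Rem μ c0) (i : ZMod ℓ) (c : ℤ) :
    gg ℓ (rm μ c0) i c = gg ℓ μ i c + qq ℓ c0 i c := by
  set D : Finset ℤ := Dset μ ∪ Dset (rm μ c0) ∪ {c0, c0 + 1, c0 - 1} with hD
  have m0 : c0 ∈ D := by simp [hD]
  have m1 : c0 + 1 ∈ D := by simp [hD]
  have m2 : c0 - 1 ∈ D := by simp [hD]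
  rw [gg_eq_sum ℓ μ i c D (by intro x hx; simp [hD, hx]),
    gg_eq_sum ℓ (rm μ c0) i c D (by intro x hx; simp [hD, hx])]
  have hq : ∀ y ∈ D, (if y < c ∧ (y : ZMod ℓ) = i then (1 : ℤ) else 0) =
      ∑ x ∈ D, if x < c ∧ (x : ZMod ℓ) = i then (if x = y then 1 else 0) else 0 := by
    intro y hy
    rw [Finset.sum_eq_single_of_mem y hy]
    · simp
    · intro x _ hxy
      simp [hxy]
  rw [qq, hq _ m0, hq _ m1, hq _ m2, Finset.mul_sum, ← Finset.sum_sub_distrib,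
    ← Finset.sum_sub_distrib, ← Finset.sum_add_distrib]
  apply Finset.sum_congr rfl
  intro x _
  rw [dd_rm h]
  split_ifs <;> simp_all

/-! ### Local operators -/

/-- Value of the local operator on a basis vector. -/
noncomputable def lvec (ℓ : ℕ) (c : ℤ) (lam : YoungDiagram) : Fock :=
  if Rem lam c then v ^ (gg ℓ (rm lam c) (c : ZMod ℓ) c) • Finsupp.single (rm lam c) (1 : RatFunc ℚ)
  else 0

/-- The local operator removing a box of content `c`. -/
noncomputable def lop (ℓ : ℕ) (c : ℤ) : Module.End (RatFunc ℚ) Fock :=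
  Finsupp.lsum (RatFunc ℚ) fun lam => LinearMap.toSpanSingleton (RatFunc ℚ) Fock (lvec ℓ c lam)

theorem lop_single (ℓ : ℕ) (c : ℤ) (lam : YoungDiagram) :
    lop ℓ c (Finsupp.single lam 1) = lvec ℓ c lam := by
  simp [lop]

theorem lop_pos (ℓ : ℕ) {c : ℤ} {lam : YoungDiagram} (h : Rem lam c) :
    lop ℓ c (Finsupp.single lam 1) =
      v ^ (gg ℓ (rm lam c) (c : ZMod ℓ) c) • Finsupp.single (rm lam c) (1 : RatFunc ℚ) := by
  rw [lop_single, lvec, if_pos h]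

theorem lop_neg (ℓ : ℕ) {c : ℤ} {lam : YoungDiagram} (h : ¬ Rem lam c) :
    lop ℓ c (Finsupp.single lam 1) = 0 := by
  rw [lop_single, lvec, if_neg h]

theorem Eop_single (ℓ : ℕ) (i : ZMod ℓ) (lam : YoungDiagram) :
    Eop ℓ i (Finsupp.single lam 1) = Evec ℓ i lam := by
  simp [Eop]

theorem Evec_eq (ℓ : ℕ) (i : ZMod ℓ) (lam : YoungDiagram) (S : Finset ℤ) (hS : conts lam ⊆ S) :
    Evec ℓ i lam = ∑ c ∈ S.filter (fun c : ℤ => (c : ZMod ℓ) = i), lvec ℓ c lam := by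
  have hR : R ℓ i lam = (((S.filter (fun c : ℤ => (c : ZMod ℓ) = i ∧ Rem lam c)).image (rbox lam) :
      Finset (ℕ × ℕ)) : Set (ℕ × ℕ)) := by
    ext b
    simp only [R, color, Set.mem_ofPred_eq, Finset.coe_image, Finset.coe_filter, Set.mem_image]
    constructor
    · rintro ⟨h1, h2⟩
      have hr := ((isRemovable_iff lam b).1 h1).1
      exact ⟨content b, ⟨hS hr.mem_conts, h2, hr⟩, (eq_rbox h1).symm⟩
    · rintro ⟨x, ⟨-, h2, h1⟩, rfl⟩
      rw [content_rbox h1]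
      exact ⟨isRemovable_rbox h1, h2⟩
  rw [Evec, hR, finsum_mem_coe_finset, Finset.sum_image]
  · rw [← Finset.filter_filter, Finset.sum_filter]
    apply Finset.sum_congr rfl
    intro c hc
    rw [Finset.mem_filter] at hc
    rw [lvec]
    split_ifs with h
    · rw [neg_Nr, content_rbox h, hc.2]; rfl
    · rfl
  · intro x hx y hy hxy
    simp only [Finset.coe_filter, Set.mem_ofPred_eq] at hx hy
    rw [← content_rbox hx.2.2, hxy, content_rbox hy.2.2]

theorem Rem_rm_iff {μ : YoungDiagram} {c c' : ℤ} (h : Rem μ c) (hc : c + 2 ≤ c' ∨ c' + 2 ≤ c) :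
    Rem (rm μ c) c' ↔ Rem μ c' := by
  unfold Rem
  rw [prof_rm h, prof_rm h, prof_rm h, if_neg (by omega), if_neg (by omega), if_neg (by omega)]

theorem rm_comm {μ : YoungDiagram} {c c' : ℤ} (h : Rem μ c) (h' : Rem μ c')
    (hc : c + 2 ≤ c' ∨ c' + 2 ≤ c) : rm (rm μ c) c' = rm (rm μ c') c := by
  apply prof_inj
  intro x
  have h1 := (Rem_rm_iff h hc).2 h'
  have h2 := (Rem_rm_iff h' hc.symm).2 h
  rw [prof_rm h1, prof_rm h2, prof_rm h, prof_rm h, prof_rm h', prof_rm h']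
  split_ifs <;> first | rfl | omega

theorem v_ne : v ≠ 0 := RatFunc.X_ne_zero

theorem lop_ext {f g : Module.End (RatFunc ℚ) Fock}
    (h : ∀ lam, f (Finsupp.single lam 1) = g (Finsupp.single lam 1)) : f = g := by
  apply Finsupp.lhom_ext'
  intro lam
  apply LinearMap.ext_ring
  simpa using h lam

theorem lop_comm (ℓ : ℕ) {c c' : ℤ} (hc : c + 2 ≤ c' ∨ c' + 2 ≤ c) :
    lop ℓ c' * lop ℓ c =
      v ^ (qq ℓ c (c' : ZMod ℓ) c' - qq ℓ c' (c : ZMod ℓ) c) • (lop ℓ c * lop ℓ c') := by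
  apply lop_ext
  intro lam
  rw [LinearMap.smul_apply, Module.End.mul_apply, Module.End.mul_apply]
  by_cases h : Rem lam c
  · by_cases h' : Rem lam c'
    · have h1 := (Rem_rm_iff h hc).2 h'
      have h2 := (Rem_rm_iff h' hc.symm).2 h
      have e := rm_comm h h' hc
      have k1 : gg ℓ (rm (rm lam c) c') (c' : ZMod ℓ) c' =
          gg ℓ (rm lam c') (c' : ZMod ℓ) c' + qq ℓ c (c' : ZMod ℓ) c' := by rw [e, gg_rm ℓ h2]
      have k2 : gg ℓ (rm (rm lam c') c) (c : ZMod ℓ) c =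
          gg ℓ (rm lam c) (c : ZMod ℓ) c + qq ℓ c' (c : ZMod ℓ) c := by rw [← e, gg_rm ℓ h1]
      rw [lop_pos ℓ h, lop_pos ℓ h', map_smul, map_smul, lop_pos ℓ h1, lop_pos ℓ h2,
        smul_smul, smul_smul, smul_smul, k1, k2, e, ← zpow_add₀ v_ne, ← zpow_add₀ v_ne,
        ← zpow_add₀ v_ne]
      congr 2
      ring
    · rw [lop_neg ℓ h', lop_pos ℓ h, map_smul, lop_neg ℓ (mt (Rem_rm_iff h hc).1 h')]
      simp
  · by_cases h' : Rem lam c'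
    · rw [lop_neg ℓ h, lop_pos ℓ h', map_smul, lop_neg ℓ (mt (Rem_rm_iff h' hc.symm).1 h)]
      simp
    · rw [lop_neg ℓ h, lop_neg ℓ h']
      simp

theorem not_Rem_rm {μ : YoungDiagram} {c : ℤ} (h : Rem μ c) : ¬ Rem (rm μ c) c := by
  rintro ⟨h1, h2⟩
  obtain ⟨h3, h4⟩ := h
  rw [prof_rm ⟨h3, h4⟩, prof_rm ⟨h3, h4⟩] at h1
  rw [if_neg (by omega), if_pos rfl] at h1
  omega

theorem lop_sq (ℓ : ℕ) (c : ℤ) : lop ℓ c * lop ℓ c = 0 := by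
  apply lop_ext
  intro lam
  rw [Module.End.mul_apply, LinearMap.zero_apply]
  by_cases h : Rem lam c
  · rw [lop_pos ℓ h, map_smul, lop_neg ℓ (not_Rem_rm h), smul_zero]
  · rw [lop_neg ℓ h, map_zero]

theorem lop_triple (ℓ : ℕ) {c z : ℤ} (hz : z = c + 1 ∨ z = c - 1) :
    lop ℓ c * (lop ℓ z * lop ℓ c) = 0 := by
  apply lop_ext
  intro lam
  rw [Module.End.mul_apply, Module.End.mul_apply, LinearMap.zero_apply]
  by_cases h : Rem lam c
  · rw [lop_pos ℓ h, map_smul, map_smul]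
    by_cases h1 : Rem (rm lam c) z
    · have h2 : ¬ Rem (rm (rm lam c) z) c := by
        rintro ⟨k1, k2⟩
        rw [prof_rm h1, prof_rm h1, prof_rm h, prof_rm h, prof_rm h] at k1 k2
        obtain ⟨h3, h4⟩ := h
        have e1 : c - 1 ≠ c := by omega
        have e2 : c + 1 ≠ c := by omega
        rcases hz with rfl | rfl
        · have e3 : c - 1 ≠ c + 1 := by omega
          simp [e3, e1.symm] at k1 k2
          omega
        · have e3 : c + 1 ≠ c - 1 := by omega
          simp [e3, e1.symm] at k1 k2
          omega
      rw [lop_pos ℓ h1, map_smul, lop_neg ℓ h2, smul_zero, smul_zero]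
    · rw [lop_neg ℓ h1, map_zero, smul_zero]
  · rw [lop_neg ℓ h, map_zero, map_zero]

/-! ### The quantum Serre relation -/

theorem serre_aux1 {K M : Type*} [Field K] [Ring M] [Algebra K M] {w : K} (hw : w ≠ 0) {a b z : M}
    (hba : b * a = w ^ 2 • (a * b)) (hza : z * a = w⁻¹ • (a * z)) :
    (a * (b * z) - (w + w⁻¹) • (a * (z * b)) + z * (a * b)) +
      (b * (a * z) - (w + w⁻¹) • (b * (z * a)) + z * (b * a)) = 0 := by
  have e1 : b * (a * z) = w ^ 2 • (a * (b * z)) := by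
    rw [← mul_assoc, hba, smul_mul_assoc, mul_assoc]
  have e2 : b * (z * a) = w • (a * (b * z)) := by
    rw [hza, mul_smul_comm, e1, smul_smul]
    congr 1; field_simp
  have e3 : z * (a * b) = w⁻¹ • (a * (z * b)) := by
    rw [← mul_assoc, hza, smul_mul_assoc, mul_assoc]
  have e4 : z * (b * a) = w • (a * (z * b)) := by
    rw [hba, mul_smul_comm, e3, smul_smul]
    congr 1; field_simp
  rw [e4, e3, e2, e1]
  match_scalars <;> field_simp <;> ring

theorem serre_aux2 {K M : Type*} [Field K] [Ring M] [Algebra K M] {w : K} (hw : w ≠ 0) {a b z : M}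
    (hba : b * a = w ^ 2 • (a * b)) (hzb : z * b = w • (b * z)) :
    (a * (b * z) - (w + w⁻¹) • (a * (z * b)) + z * (a * b)) +
      (b * (a * z) - (w + w⁻¹) • (b * (z * a)) + z * (b * a)) = 0 := by
  have hab : a * b = (w ^ 2)⁻¹ • (b * a) := by
    rw [hba, smul_smul, inv_mul_cancel₀ (pow_ne_zero 2 hw), one_smul]
  have e1 : b * (a * z) = w ^ 2 • (a * (b * z)) := by
    rw [← mul_assoc, hba, smul_mul_assoc, mul_assoc]
  have e2 : a * (z * b) = w • (a * (b * z)) := by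
    rw [hzb, mul_smul_comm]
  have e4 : z * (b * a) = w • (b * (z * a)) := by
    rw [← mul_assoc, hzb, smul_mul_assoc, mul_assoc]
  have e3 : z * (a * b) = w⁻¹ • (b * (z * a)) := by
    rw [hab, mul_smul_comm, e4, smul_smul]
    congr 1; field_simp
  rw [e4, e3, e2, e1]
  match_scalars <;> field_simp <;> ring

theorem serre_aux3 {K M : Type*} [Field K] [Ring M] [Algebra K M] {w : K} {a z : M}
    (h1 : a * a = 0) (h2 : a * (z * a) = 0) :
    a * (a * z) - (w + w⁻¹) • (a * (z * a)) + z * (a * a) = 0 := by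
  rw [← mul_assoc, h1, h2]
  simp

theorem serre_sum {K M : Type*} [Field K] [CharZero K] [Ring M] [Algebra K M] (w : K)
    (L : ℤ → M) (P Q : Finset ℤ)
    (hs : ∀ a ∈ P, ∀ b ∈ P, ∀ z ∈ Q,
      (L a * (L b * L z) - w • (L a * (L z * L b)) + L z * (L a * L b)) +
      (L b * (L a * L z) - w • (L b * (L z * L a)) + L z * (L b * L a)) = 0) :
    (∑ a ∈ P, L a) * ((∑ a ∈ P, L a) * (∑ a ∈ Q, L a))
      - w • ((∑ a ∈ P, L a) * ((∑ a ∈ Q, L a) * (∑ a ∈ P, L a)))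
      + (∑ a ∈ Q, L a) * ((∑ a ∈ P, L a) * (∑ a ∈ P, L a)) = 0 := by
  have e0 : (∑ a ∈ P, L a) * ((∑ a ∈ P, L a) * (∑ a ∈ Q, L a))
      - w • ((∑ a ∈ P, L a) * ((∑ a ∈ Q, L a) * (∑ a ∈ P, L a)))
      + (∑ a ∈ Q, L a) * ((∑ a ∈ P, L a) * (∑ a ∈ P, L a)) =
      ∑ z ∈ Q, ∑ a ∈ P, ∑ b ∈ P,
        (L a * (L b * L z) - w • (L a * (L z * L b)) + L z * (L a * L b)) := by
    simp only [Finset.sum_add_distrib, Finset.sum_sub_distrib, ← Finset.smul_sum,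
      ← Finset.mul_sum, ← Finset.sum_mul]
  rw [e0]
  refine Finset.sum_eq_zero fun z hz => ?_
  set f : ℤ → ℤ → M := fun a b =>
    L a * (L b * L z) - w • (L a * (L z * L b)) + L z * (L a * L b) with hf
  change ∑ a ∈ P, ∑ b ∈ P, f a b = 0
  have e1 : (∑ a ∈ P, ∑ b ∈ P, f a b) + (∑ a ∈ P, ∑ b ∈ P, f b a) = 0 := by
    rw [← Finset.sum_add_distrib]
    refine Finset.sum_eq_zero fun a ha => ?_
    rw [← Finset.sum_add_distrib]
    exact Finset.sum_eq_zero fun b hb => hs a ha b hb z hz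
  rw [Finset.sum_comm (f := fun a b => f b a), ← two_smul K] at e1
  exact (smul_eq_zero.1 e1).resolve_left two_ne_zero

section colors

variable {ℓ : ℕ}


theorem one_ne (hℓ : 3 ≤ ℓ) : (1 : ZMod ℓ) ≠ 0 := by
  intro h
  have : ((1 : ℕ) : ZMod ℓ) = 0 := by simpa using h
  rw [ZMod.natCast_eq_zero_iff] at this
  have := Nat.le_of_dvd (by norm_num) this
  omega

theorem two_ne (hℓ : 3 ≤ ℓ) : (2 : ZMod ℓ) ≠ 0 := by
  intro h
  have : ((2 : ℕ) : ZMod ℓ) = 0 := by simpa using h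
  rw [ZMod.natCast_eq_zero_iff] at this
  have := Nat.le_of_dvd (by norm_num) this
  omega

theorem gap (hℓ : 3 ≤ ℓ) {a b : ℤ} (hab : a < b) (h : (a : ZMod ℓ) = b) : a + 3 ≤ b := by
  have h1 := (ZMod.intCast_eq_intCast_iff_dvd_sub a b ℓ).1 h
  have := Int.le_of_dvd (by omega) h1
  omega

theorem lop_same (hℓ : 3 ≤ ℓ) {a b : ℤ} (hab : a < b) (h : (a : ZMod ℓ) = b) :
    lop ℓ b * lop ℓ a = v ^ 2 • (lop ℓ a * lop ℓ b) := by
  have hg := gap hℓ hab h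
  have h1 := one_ne hℓ
  rw [lop_comm ℓ (Or.inl (by omega))]
  have q1 : qq ℓ a (b : ZMod ℓ) b = 2 := by
    have n1 : ¬ (((a + 1 : ℤ) : ZMod ℓ) = b) := by
      intro h'; push_cast at h'; apply h1; linear_combination h' - h
    have n2 : ¬ (((a - 1 : ℤ) : ZMod ℓ) = b) := by
      intro h'; push_cast at h'; apply h1; linear_combination h - h'
    simp only [qq, n1, n2, h, hab, and_self, and_false, if_true, if_false]
    norm_num
  have q2 : qq ℓ b (a : ZMod ℓ) a = 0 := by
    have n1 : ¬ (b < a) := by omega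
    have n2 : ¬ (b + 1 < a) := by omega
    have n3 : ¬ (b - 1 < a) := by omega
    simp only [qq, n1, n2, n3, false_and, if_false]
    norm_num
  rw [q1, q2]
  norm_cast

theorem qq_adj (hℓ : 3 ≤ ℓ) {c z : ℤ} (h : (z : ZMod ℓ) = c + 1 ∨ (z : ZMod ℓ) = c - 1)
    (hc : c + 2 ≤ z) : qq ℓ c (z : ZMod ℓ) z = -1 := by
  have h1 := one_ne hℓ
  have h2 := two_ne hℓ
  have o2 : c + 1 < z := by omega
  have o3 : c - 1 < z := by omega
  have n0 : ¬ ((c : ZMod ℓ) = z) := by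
    intro h'
    apply h1
    rcases h with h | h
    · linear_combination -h' - h
    · linear_combination h' + h
  rcases h with h | h
  · have n1 : ((c + 1 : ℤ) : ZMod ℓ) = z := by push_cast; exact h.symm
    have n2 : ¬ (((c - 1 : ℤ) : ZMod ℓ) = z) := by
      intro h'; push_cast at h'; apply h2; linear_combination -h' - h
    simp only [qq, n0, n1, n2, o2, and_self, and_false, if_true, if_false]
    norm_num
  · have n1 : ((c - 1 : ℤ) : ZMod ℓ) = z := by push_cast; exact h.symm
    have n2 : ¬ (((c + 1 : ℤ) : ZMod ℓ) = z) := by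
      intro h'; push_cast at h'; apply h2; linear_combination h' + h
    simp only [qq, n0, n1, n2, o3, and_self, and_false, if_true, if_false]
    norm_num

theorem qq_zero (ℓ : ℕ) {c z : ℤ} (i : ZMod ℓ) (hc : c + 2 ≤ z) : qq ℓ z i c = 0 := by
  have n1 : ¬ (z < c) := by omega
  have n2 : ¬ (z + 1 < c) := by omega
  have n3 : ¬ (z - 1 < c) := by omega
  simp only [qq, n1, n2, n3, false_and, if_false]
  norm_num

theorem lop_gt (hℓ : 3 ≤ ℓ) {c z : ℤ} (h : (z : ZMod ℓ) = c + 1 ∨ (z : ZMod ℓ) = c - 1)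
    (hc : c + 2 ≤ z) : lop ℓ z * lop ℓ c = v⁻¹ • (lop ℓ c * lop ℓ z) := by
  rw [lop_comm ℓ (Or.inl hc), qq_adj hℓ h hc, qq_zero ℓ _ hc]
  norm_num

theorem lop_lt (hℓ : 3 ≤ ℓ) {c z : ℤ} (h : (z : ZMod ℓ) = c + 1 ∨ (z : ZMod ℓ) = c - 1)
    (hc : z + 2 ≤ c) : lop ℓ z * lop ℓ c = v • (lop ℓ c * lop ℓ z) := by
  have h' : (c : ZMod ℓ) = z + 1 ∨ (c : ZMod ℓ) = z - 1 := by
    rcases h with h | h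
    · right; rw [h]; ring
    · left; rw [h]; ring
  rw [lop_comm ℓ (Or.inr hc), qq_adj hℓ h' hc, qq_zero ℓ _ hc]
  norm_num

theorem adj_ne (hℓ : 3 ≤ ℓ) {c z : ℤ} (h : (z : ZMod ℓ) = c + 1 ∨ (z : ZMod ℓ) = c - 1) :
    z ≠ c := by
  rintro rfl
  apply one_ne hℓ
  rcases h with h | h
  · linear_combination -h
  · linear_combination h

/-- One term of the Serre relation. -/
noncomputable def term (ℓ : ℕ) (a b z : ℤ) : Module.End (RatFunc ℚ) Fock :=
  lop ℓ a * (lop ℓ b * lop ℓ z) - (v + v⁻¹) • (lop ℓ a * (lop ℓ z * lop ℓ b))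
    + lop ℓ z * (lop ℓ a * lop ℓ b)

theorem term_symm_lt (hℓ : 3 ≤ ℓ) {a b z : ℤ} (hab : a < b) (h : (a : ZMod ℓ) = b)
    (hz : (z : ZMod ℓ) = a + 1 ∨ (z : ZMod ℓ) = a - 1) : term ℓ a b z + term ℓ b a z = 0 := by
  have hg := gap hℓ hab h
  by_cases hc : a + 2 ≤ z
  · exact serre_aux1 (K := RatFunc ℚ) (M := Module.End (RatFunc ℚ) Fock) v_ne (lop_same hℓ hab h) (lop_gt hℓ hz hc)
  · exact serre_aux2 (K := RatFunc ℚ) (M := Module.End (RatFunc ℚ) Fock) v_ne (lop_same hℓ hab h) (lop_lt hℓ (h ▸ hz) (by omega))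

theorem term_self (hℓ : 3 ≤ ℓ) {a z : ℤ}
    (hz : (z : ZMod ℓ) = a + 1 ∨ (z : ZMod ℓ) = a - 1) : term ℓ a a z = 0 := by
  have hne := adj_ne hℓ hz
  have e1 : lop ℓ a * (lop ℓ z * lop ℓ a) = 0 := by
    by_cases h1 : z = a + 1 ∨ z = a - 1
    · exact lop_triple ℓ h1
    · rw [lop_comm ℓ (c := a) (c' := z) (by omega), mul_smul_comm, ← mul_assoc, lop_sq, zero_mul,
        smul_zero]
  exact serre_aux3 (K := RatFunc ℚ) (M := Module.End (RatFunc ℚ) Fock) (lop_sq ℓ a) e1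

theorem term_symm (hℓ : 3 ≤ ℓ) {a b z : ℤ} (h : (a : ZMod ℓ) = b)
    (hz : (z : ZMod ℓ) = a + 1 ∨ (z : ZMod ℓ) = a - 1) : term ℓ a b z + term ℓ b a z = 0 := by
  rcases lt_trichotomy a b with hab | rfl | hab
  · exact term_symm_lt hℓ hab h hz
  · rw [term_self hℓ hz, add_zero]
  · rw [add_comm]
    exact term_symm_lt hℓ hab h.symm (h ▸ hz)

end colors

/-- Finite truncation of the operator `E_i`. -/
noncomputable def Etr (ℓ : ℕ) (S : Finset ℤ) (i : ZMod ℓ) : Module.End (RatFunc ℚ) Fock :=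
  ∑ c ∈ S.filter (fun c : ℤ => (c : ZMod ℓ) = i), lop ℓ c

theorem Etr_serre {ℓ : ℕ} (hℓ : 3 ≤ ℓ) (S : Finset ℤ) (i j : ZMod ℓ) (h : j = i + 1 ∨ j = i - 1) :
    Etr ℓ S i * (Etr ℓ S i * Etr ℓ S j) - (v + v⁻¹) • (Etr ℓ S i * (Etr ℓ S j * Etr ℓ S i))
      + Etr ℓ S j * (Etr ℓ S i * Etr ℓ S i) = 0 := by
  refine serre_sum (K := RatFunc ℚ) (M := Module.End (RatFunc ℚ) Fock) (v + v⁻¹) (lop ℓ) _ _ ?_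
  intro a ha b hb z hz
  rw [Finset.mem_filter] at ha hb hz
  exact term_symm hℓ (ha.2.trans hb.2.symm) (by rw [ha.2, hz.2]; exact h)

/-- Span of the basis vectors below `lam`. -/
noncomputable def below (lam : YoungDiagram) : Submodule (RatFunc ℚ) Fock :=
  Submodule.span (RatFunc ℚ) ((fun μ => Finsupp.single μ (1 : RatFunc ℚ)) '' {μ | μ ≤ lam})

theorem conts_mono {μ lam : YoungDiagram} (h : μ ≤ lam) : conts μ ⊆ conts lam :=
  Finset.image_subset_image h

theorem Eop_eq_Etr (ℓ : ℕ) (i : ZMod ℓ) (lam : YoungDiagram) {f : Fock} (hf : f ∈ below lam) :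
    Eop ℓ i f = Etr ℓ (conts lam) i f := by
  refine LinearMap.eqOn_span (f := Eop ℓ i) (g := Etr ℓ (conts lam) i) ?_ hf
  rintro _ ⟨μ, hμ, rfl⟩
  simp only
  rw [Eop_single, Evec_eq ℓ i μ (conts lam) (conts_mono hμ), Etr, LinearMap.sum_apply]
  exact Finset.sum_congr rfl fun c _ => (lop_single ℓ c μ).symm

theorem Etr_below (ℓ : ℕ) (S : Finset ℤ) (i : ZMod ℓ) (lam : YoungDiagram) {f : Fock}
    (hf : f ∈ below lam) : Etr ℓ S i f ∈ below lam := by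
  have : below lam ≤ (below lam).comap (Etr ℓ S i) := by
    refine Submodule.span_le.2 ?_
    rintro _ ⟨μ, hμ, rfl⟩
    change Etr ℓ S i (Finsupp.single μ 1) ∈ below lam
    rw [Etr, LinearMap.sum_apply]
    refine Submodule.sum_mem _ fun c _ => ?_
    rw [lop_single, lvec]
    split_ifs with h
    · exact Submodule.smul_mem _ _ (Submodule.subset_span ⟨_, (rm_le h).trans hμ, rfl⟩)
    · exact Submodule.zero_mem _
  exact this hf

theorem stmt5 (ℓ : ℕ) (hℓ : 3 ≤ ℓ) (i j : ZMod ℓ) (h : j = i + 1 ∨ j = i - 1) :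
    Eop ℓ i ∘ₗ Eop ℓ i ∘ₗ Eop ℓ j - (v + v⁻¹) • (Eop ℓ i ∘ₗ Eop ℓ j ∘ₗ Eop ℓ i)
      + Eop ℓ j ∘ₗ Eop ℓ i ∘ₗ Eop ℓ i = 0 := by
  apply lop_ext (f := Eop ℓ i ∘ₗ Eop ℓ i ∘ₗ Eop ℓ j -
    (v + v⁻¹) • (Eop ℓ i ∘ₗ Eop ℓ j ∘ₗ Eop ℓ i) + Eop ℓ j ∘ₗ Eop ℓ i ∘ₗ Eop ℓ i) (g := 0)
  intro lam
  have hx : Finsupp.single lam (1 : RatFunc ℚ) ∈ below lam :=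
    Submodule.subset_span ⟨lam, le_refl lam, rfl⟩
  have hserre := LinearMap.congr_fun (Etr_serre hℓ (conts lam) i j h) (Finsupp.single lam 1)
  generalize Finsupp.single lam (1 : RatFunc ℚ) = x at hx hserre ⊢
  have hi := Etr_below ℓ (conts lam) i lam hx
  have hj := Etr_below ℓ (conts lam) j lam hx
  simp only [LinearMap.add_apply, LinearMap.sub_apply, LinearMap.smul_apply,
    LinearMap.comp_apply, Module.End.mul_apply] at hserre ⊢
  rw [Eop_eq_Etr ℓ j lam hx, Eop_eq_Etr ℓ i lam hx, Eop_eq_Etr ℓ i lam hj, Eop_eq_Etr ℓ i lam hi,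
    Eop_eq_Etr ℓ j lam hi, Eop_eq_Etr ℓ i lam (Etr_below ℓ _ i lam hj),
    Eop_eq_Etr ℓ i lam (Etr_below ℓ _ j lam hi), Eop_eq_Etr ℓ j lam (Etr_below ℓ _ i lam hi)]
  exact hserre

end MisraMiwa
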